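/- arXiv:1601.07500 — 2 statements merged into one kernel-verified Lean document; each statement's English description precedes it below -/
import Mathlib

section
/- For the triple cross product on ℝ⁸ (octonions), the vector u×v×w is orthogonal to each of u, v, and w. -/
noncomputable section

/-- The octonions `𝕆 ≅ ℝ⁸`, realized as pairs of quaternions via Cayley–Dickson. -/
abbrev Octonion : Type := Quaternion ℝ × Quaternion ℝ

/-- Octonion multiplication (Cayley–Dickson doubling of the quaternions). -/
def omul (p q : Octonion) : Octonion :=
  (p.1 * q.1 - star q.2 * p.2, q.2 * p.1 + p.2 * star q.1)

/-- Octonion conjugation. -/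
def oconj (p : Octonion) : Octonion := (star p.1, -p.2)

/-- The standard inner product on the octonions `≅ ℝ⁸`. -/
def oinner (p q : Octonion) : ℝ := (p.1 * star q.1).re + (p.2 * star q.2).re

/-- The triple cross product `u×v×w = ½(u(v̄w) − w(v̄u))`. -/
def tcross (u v w : Octonion) : Octonion :=
  (2 : ℝ)⁻¹ • (omul u (omul (oconj v) w) - omul w (omul (oconj v) u))

/-- The Cayley 4-form `Ψ(u,v,w,z) = ⟨u×v×w, z⟩`. -/
def cayleyΨ (u v w z : Octonion) : ℝ := oinner (tcross u v w) z

theorem oinner_comm (p q : Octonion) : oinner p q = oinner q p := by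
  simp only [oinner, Quaternion.re_mul, Quaternion.re_star, Quaternion.imI_star,
    Quaternion.imJ_star, Quaternion.imK_star]
  ring

theorem oinner_smul_left (a : ℝ) (p q : Octonion) : oinner (a • p) q = a * oinner p q := by
  simp only [oinner, Prod.smul_fst, Prod.smul_snd, smul_mul_assoc, Quaternion.re_smul,
    smul_eq_mul, mul_add]

theorem oinner_sub_left (p q r : Octonion) : oinner (p - q) r = oinner p r - oinner q r := by
  simp only [oinner, Prod.fst_sub, Prod.snd_sub, sub_mul, Quaternion.re_sub]
  ring

theorem oinner_tcross (u v w z : Octonion) :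
    oinner (tcross u v w) z =
      2⁻¹ * (oinner (omul u (omul (oconj v) w)) z - oinner (omul w (omul (oconj v) u)) z) := by
  rw [tcross, oinner_smul_left, oinner_sub_left]

/-- The triple cross product is antisymmetric in its outer arguments. -/
theorem tcross_swap (u v w : Octonion) : tcross w v u = -tcross u v w := by
  rw [tcross, tcross, ← smul_neg, neg_sub]

theorem oinner_neg_left (p q : Octonion) : oinner (-p) q = -oinner p q := by
  simp only [oinner, Prod.fst_neg, Prod.snd_neg, neg_mul, Quaternion.re_neg]
  ring

/-- Left multiplication by `p̄` is adjoint to left multiplication by `p`. -/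
theorem oinner_omul_left (p q r : Octonion) :
    oinner (omul p q) r = oinner q (omul (oconj p) r) := by
  simp only [oinner, omul, oconj, Quaternion.re_mul, Quaternion.imI_mul, Quaternion.imJ_mul,
    Quaternion.imK_mul, Quaternion.re_star, Quaternion.imI_star, Quaternion.imJ_star,
    Quaternion.imK_star, Quaternion.re_sub, Quaternion.imI_sub, Quaternion.imJ_sub,
    Quaternion.imK_sub, Quaternion.re_add, Quaternion.imI_add, Quaternion.imJ_add,
    Quaternion.imK_add, Quaternion.re_neg, Quaternion.imI_neg, Quaternion.imJ_neg,
    Quaternion.imK_neg]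
  ring

theorem oinner_oconj (p q : Octonion) : oinner (oconj p) (oconj q) = oinner p q := by
  simp only [oinner, oconj, Quaternion.re_mul, Quaternion.re_star, Quaternion.imI_star,
    Quaternion.imJ_star, Quaternion.imK_star, star_neg, neg_mul_neg]

theorem oconj_omul (p q : Octonion) : oconj (omul p q) = omul (oconj q) (oconj p) := by
  simp only [oconj, omul, star_sub, star_mul, star_star, star_neg, neg_mul, mul_neg, neg_add,
    Prod.mk.injEq]
  exact ⟨by abel, by abel⟩

theorem oconj_oconj (p : Octonion) : oconj (oconj p) = p := by
  simp only [oconj, star_star, neg_neg]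

/-- Left multiplication by `p̄ p` is multiplication by `‖p‖²`. -/
theorem omul_oconj_omul (p q : Octonion) : omul (oconj p) (omul p q) = oinner p p • q := by
  ext <;>
  · simp only [oinner, omul, oconj, Prod.smul_fst, Prod.smul_snd, Quaternion.re_smul,
      Quaternion.imI_smul, Quaternion.imJ_smul, Quaternion.imK_smul, smul_eq_mul,
      Quaternion.re_mul, Quaternion.imI_mul, Quaternion.imJ_mul,
      Quaternion.imK_mul, Quaternion.re_star, Quaternion.imI_star, Quaternion.imJ_star,
      Quaternion.imK_star, Quaternion.re_sub, Quaternion.imI_sub, Quaternion.imJ_sub,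
      Quaternion.imK_sub, Quaternion.re_add, Quaternion.imI_add, Quaternion.imJ_add,
      Quaternion.imK_add, Quaternion.re_neg, Quaternion.imI_neg, Quaternion.imJ_neg,
      Quaternion.imK_neg]
    ring

/-- Left multiplication by `p` scales the inner product by `‖p‖²`. -/
theorem oinner_omul_omul_left (p q r : Octonion) :
    oinner (omul p q) (omul p r) = oinner p p * oinner q r := by
  rw [oinner_comm, oinner_omul_left, omul_oconj_omul, oinner_comm, oinner_smul_left]

theorem omul_one_right (p : Octonion) : omul p (1, 0) = p := by
  simp [omul]

/-- Right multiplication by `r` scales the inner product by `‖r‖²`. -/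
theorem oinner_omul_omul_right (p q r : Octonion) :
    oinner (omul p r) (omul q r) = oinner p q * oinner r r := by
  rw [← oinner_oconj, oconj_omul, oconj_omul, oinner_omul_omul_left, oinner_oconj, oinner_oconj,
    mul_comm]

theorem oinner_tcross_left (u v w : Octonion) : oinner (tcross u v w) u = 0 := by
  have h : oinner (omul u (omul (oconj v) w)) u = oinner v w * oinner u u := by
    calc
      _ = oinner (omul u (omul (oconj v) w)) (omul u (1, 0)) := by rw [omul_one_right]
      _ = oinner u u * oinner w v := by
        rw [oinner_omul_omul_left, oinner_omul_left, oconj_oconj, omul_one_right]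
      _ = _ := by rw [oinner_comm w, mul_comm]
  rw [oinner_tcross, h, oinner_omul_left w, oinner_omul_omul_right, oinner_oconj, sub_self,
    mul_zero]

theorem oinner_tcross_middle (u v w : Octonion) : oinner (tcross u v w) v = 0 := by
  have h : oinner (omul (oconj v) u) (omul (oconj w) v) =
      oinner (omul (oconj v) w) (omul (oconj u) v) := by
    rw [← oinner_oconj, oconj_omul, oconj_omul, oconj_oconj, oconj_oconj, oinner_comm]
  rw [oinner_tcross, oinner_omul_left u, oinner_omul_left w, h, sub_self, mul_zero]

/-- the triple cross product `u×v×w` is orthogonal to `u`, `v` and `w`. -/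
theorem tcross_orthogonal (u v w : Octonion) :
    oinner (tcross u v w) u = 0 ∧ oinner (tcross u v w) v = 0 ∧
      oinner (tcross u v w) w = 0 := by
  refine ⟨oinner_tcross_left u v w, oinner_tcross_middle u v w, ?_⟩
  rw [← neg_eq_zero, ← oinner_neg_left, ← tcross_swap]
  exact oinner_tcross_left w v u
end
end

section
/- The Cayley 4-form Ψ on ℝ⁸ is a calibration whose Cayley inequality is an equality exactly on Cayley planes: for any orthonormal u, v, w, z, Ψ(u,v,w,z) = 1 if and only if z = u×v×w. -/
noncomputable section

/-- The polarization of the identity `p(p̄w) = ⟨p, p⟩w`. -/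
theorem omul_omul_oconj_add (u v w : Octonion) :
    omul u (omul (oconj v) w) + omul v (omul (oconj u) w) = (2 * oinner u v) • w := by
  ext <;> simp only [omul, oconj, oinner, Prod.fst_add, Prod.snd_add, Prod.smul_fst,
    Prod.smul_snd, Quaternion.re_add, Quaternion.imI_add, Quaternion.imJ_add, Quaternion.imK_add,
    Quaternion.re_sub, Quaternion.imI_sub, Quaternion.imJ_sub, Quaternion.imK_sub,
    Quaternion.re_neg, Quaternion.imI_neg, Quaternion.imJ_neg, Quaternion.imK_neg,
    Quaternion.re_mul, Quaternion.imI_mul, Quaternion.imJ_mul, Quaternion.imK_mul,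
    Quaternion.re_star, Quaternion.imI_star, Quaternion.imJ_star, Quaternion.imK_star,
    Quaternion.re_smul, Quaternion.imI_smul, Quaternion.imJ_smul, Quaternion.imK_smul,
    smul_eq_mul] <;> ring

theorem omul_oconj_add (v w : Octonion) :
    omul (oconj v) w + omul (oconj w) v = (((2 * oinner v w : ℝ) : Quaternion ℝ), 0) := by
  ext <;> simp [omul, oconj, oinner, -Quaternion.coe_mul, -Quaternion.coe_add] <;> ring

theorem omul_neg (p q : Octonion) : omul p (-q) = -omul p q := by
  ext <;> simp [omul] <;> ring

theorem oinner_omul_self (p q : Octonion) :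
    oinner (omul p q) (omul p q) = oinner p p * oinner q q := by
  simp [omul, oinner]; ring

theorem oinner_oconj_self (p : Octonion) : oinner (oconj p) (oconj p) = oinner p p := by
  simp [oconj, oinner]

theorem oinner_sub_self (p q : Octonion) :
    oinner (p - q) (p - q) = oinner p p - 2 * oinner p q + oinner q q := by
  simp [oinner]; ring

theorem oinner_self_eq_zero {p : Octonion} (h : oinner p p = 0) : p = 0 := by
  simp only [oinner, Quaternion.self_mul_star, Quaternion.re_coe] at h
  have h₁ := Quaternion.normSq_nonneg (a := p.1)
  have h₂ := Quaternion.normSq_nonneg (a := p.2)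
  exact Prod.ext (Quaternion.normSq_eq_zero.1 (by linarith))
    (Quaternion.normSq_eq_zero.1 (by linarith))

/-- On pairwise orthogonal octonions the triple cross product is the product `u(v̄w)`. -/
theorem tcross_eq_omul {u v w : Octonion} (huv : oinner u v = 0) (huw : oinner u w = 0)
    (hvw : oinner v w = 0) : tcross u v w = omul u (omul (oconj v) w) := by
  have swap {a b : Octonion} (c : Octonion) (h : oinner a b = 0) :
      omul a (omul (oconj b) c) = -omul b (omul (oconj a) c) :=
    eq_neg_of_add_eq_zero_left (by simp [omul_omul_oconj_add, h])
  have conj_swap {a b : Octonion} (h : oinner a b = 0) :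
      omul (oconj a) b = -omul (oconj b) a :=
    eq_neg_of_add_eq_zero_left (by simp [omul_oconj_add, h])
  have key : omul w (omul (oconj v) u) = -omul u (omul (oconj v) w) := by
    rw [conj_swap hvw, omul_neg, neg_neg, swap v huw, conj_swap huv, omul_neg,
      neg_neg]
  rw [tcross, key, sub_neg_eq_add, ← two_smul ℝ, smul_smul]
  norm_num

/-- the Cayley inequality is an equality exactly on Cayley planes:
for orthonormal `u, v, w, z` one has `Ψ(u,v,w,z) = 1` iff `z = u×v×w`. -/
theorem cayley_equality_iff_cayley_plane (u v w z : Octonion)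
    (horth : ∀ i j : Fin 4,
      oinner (![u, v, w, z] i) (![u, v, w, z] j) = if i = j then 1 else 0) :
    cayleyΨ u v w z = 1 ↔ z = tcross u v w := by
  have huu : oinner u u = 1 := by simpa using horth 0 0
  have hvv : oinner v v = 1 := by simpa using horth 1 1
  have hww : oinner w w = 1 := by simpa using horth 2 2
  have hzz : oinner z z = 1 := by simpa using horth 3 3
  have huv : oinner u v = 0 := by simpa using horth 0 1
  have huw : oinner u w = 0 := by simpa using horth 0 2
  have hvw : oinner v w = 0 := by simpa using horth 1 2
  have hnorm : oinner (tcross u v w) (tcross u v w) = 1 := by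
    rw [tcross_eq_omul huv huw hvw, oinner_omul_self, oinner_omul_self, oinner_oconj_self,
      huu, hvv, hww]
    norm_num
  rw [cayleyΨ]
  constructor
  · intro h
    refine (sub_eq_zero.1 (oinner_self_eq_zero ?_)).symm
    rw [oinner_sub_self, hnorm, h, hzz]
    norm_num
  · intro h
    rwa [← h] at hnorm ⊢
end
end
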